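/- The set of varieties {A_p | p is a prime number} is definable in the lattice Com, and each of the varieties SL and ZM is a definable element of Com. -/

import Mathlib

open FirstOrder

/-! ### Words, identities, and commutative semigroup varieties -/

/-- Semigroup words over the countable alphabet `ℕ`. -/
abbrev SGWord : Type := FreeSemigroup ℕ

/-- A semigroup identity `u = v` is a pair of words. -/
abbrev SGId : Type := SGWord × SGWord

/-- The one-letter word consisting of the letter `n`. -/
def ltr (n : ℕ) : SGWord := FreeSemigroup.of n

/-- `wpow w n` is the word `w^n` (for `n ≥ 1`; by convention `wpow w 0 = w`). -/
def wpow (w : SGWord) : ℕ → SGWord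
  | 0 => w
  | 1 => w
  | n + 2 => wpow w (n + 1) * w

/-- The letter `n` occurs in the word `w`. -/
def OccursIn (n : ℕ) (w : SGWord) : Prop := n = w.head ∨ n ∈ w.tail

/-- A semigroup `S` satisfies the identity `i.1 = i.2` if all evaluations of the two
words in `S` coincide. -/
def SGSatisfies (S : Type) [Semigroup S] (i : SGId) : Prop :=
  ∀ f : ℕ → S, FreeSemigroup.lift f i.1 = FreeSemigroup.lift f i.2

/-- A bundled (nonempty) commutative semigroup. -/
structure ComSG where
  carrier : Type
  [str : CommSemigroup carrier]
  [instNonempty : Nonempty carrier]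

attribute [instance] ComSG.str ComSG.instNonempty

/-- The class of commutative semigroups satisfying every identity in `E`. -/
def modelsOf (E : Set SGId) : Set ComSG := {S | ∀ i ∈ E, SGSatisfies S.carrier i}

/-- The set of identities holding in every member of the class `K`. -/
def theoryOfClass (K : Set ComSG) : Set SGId := {i | ∀ S ∈ K, SGSatisfies S.carrier i}

theorem subset_theoryOfClass_modelsOf (E : Set SGId) : E ⊆ theoryOfClass (modelsOf E) :=
  fun i hi S hS => hS i hi

theorem theoryOfClass_antitone {K K' : Set ComSG} (h : K ⊆ K') :
    theoryOfClass K' ⊆ theoryOfClass K := fun _ hi S hS => hi S (h hS)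

theorem modelsOf_antitone {E E' : Set SGId} (h : E ⊆ E') : modelsOf E' ⊆ modelsOf E :=
  fun _ hS i hi => hS i (h hi)

/-- A variety of commutative semigroups, identified with its (equationally closed)
equational theory.  Varieties are ordered by inclusion of the corresponding classes
of semigroups, i.e. by *reverse* inclusion of theories. -/
structure ComVariety where
  theory : Set SGId
  closed : theoryOfClass (modelsOf theory) = theory

theorem ComVariety.ext' {V W : ComVariety} (h : V.theory = W.theory) : V = W := by
  cases V; cases W; cases h; rfl

instance : PartialOrder ComVariety where
  le V W := W.theory ⊆ V.theory
  le_refl V := subset_rfl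
  le_trans U V W h1 h2 := fun i hi => h1 (h2 hi)
  le_antisymm V W h1 h2 := ComVariety.ext' (subset_antisymm h2 h1)

instance : SupSet ComVariety where
  sSup s :=
    { theory := ⋂ V ∈ s, V.theory
      closed := by
        apply subset_antisymm
        · intro i hi
          refine Set.mem_iInter₂.2 fun V hV => ?_
          have h1 : (⋂ V ∈ s, ComVariety.theory V) ⊆ V.theory := Set.biInter_subset_of_mem hV
          have h2 := theoryOfClass_antitone (modelsOf_antitone h1)
          rw [V.closed] at h2
          exact h2 hi
        · exact subset_theoryOfClass_modelsOf _ }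

/-- The lattice **Com** of all commutative semigroup varieties. -/
instance : CompleteLattice ComVariety :=
  completeLatticeOfSup ComVariety fun s => by
    constructor
    · intro V hV i hi
      exact Set.mem_iInter₂.1 hi V hV
    · intro W hW i hi
      exact Set.mem_iInter₂.2 fun V hV => hW hV hi

/-- The variety of commutative semigroups given by the identity system `E`. -/
def comVar (E : Set SGId) : ComVariety where
  theory := theoryOfClass (modelsOf E)
  closed := by
    apply subset_antisymm
    · exact theoryOfClass_antitone fun S hS i hi => hi S hS
    · exact subset_theoryOfClass_modelsOf _

/-! ### The first-order language of lattices and definability -/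

/-- The first-order language of lattices: two binary function symbols (`true` for the
join `∨` and `false` for the meet `∧`) and nothing else. -/
def latticeLang : Language where
  Functions := fun n => match n with | 2 => Bool | _ => Empty
  Relations := fun _ => Empty

instance latticeLangStructure (L : Type*) [Lattice L] : latticeLang.Structure L where
  funMap {n} f x :=
    match n, f with
    | 2, b => bif b then x 0 ⊔ x 1 else x 0 ⊓ x 1
    | 0, f => f.elim
    | 1, f => f.elim
    | (_ + 3), f => f.elim
  RelMap {n} r _ := r.elim

/-- A subset `A` of a lattice `L` is definable in `L` if there is a first-order formula
`φ(x)` with one free variable in the language of the lattice operations `∨` and `∧`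
such that for every `a ∈ L`, `φ(a)` holds in `L` if and only if `a ∈ A`. -/
def LatDefinable (L : Type*) [Lattice L] (A : Set L) : Prop :=
  ∃ φ : latticeLang.Formula (Fin 1), ∀ a : L, (φ.Realize fun _ => a) ↔ a ∈ A

/-! ### Named varieties -/

/-- The commutativity identity `xy = yx`. -/
def commId : SGId := (ltr 0 * ltr 1, ltr 1 * ltr 0)

/-- The pair of identities abbreviated by the symbolic identity `w = 0`, namely
`wx = w` and `xw = w`, where `x` is the letter `n` (assumed not to occur in `w`). -/
def zeroId (w : SGWord) (n : ℕ) : Set SGId := {(w * ltr n, w), (ltr n * w, w)}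

/-- `A n = var{xⁿy = y, xy = yx}`, the variety of Abelian groups of exponent dividing `n`. -/
def Avar (n : ℕ) : ComVariety := comVar {(wpow (ltr 0) n * ltr 1, ltr 1), commId}

/-- `SL = var{x² = x, xy = yx}`, the variety of semilattices. -/
def SLvar : ComVariety := comVar {(wpow (ltr 0) 2, ltr 0), commId}

/-- `ZM = var{xy = 0}` (within **Com**), the variety of null semigroups. -/
def ZMvar : ComVariety := comVar ({commId} ∪ zeroId (ltr 0 * ltr 1) 2)

/-- `T = var{x = y}`, the trivial variety. -/
def Tvar : ComVariety := comVar {(ltr 0, ltr 1)}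

/-- `COM`, the variety of all commutative semigroups. -/
def COMvar : ComVariety := comVar {commId}

/-- `C m = var{xᵐ = xᵐ⁺¹, xy = yx}` (the variety generated by the cyclic monoid
`⟨a ∣ aᵐ = aᵐ⁺¹⟩`), with the convention `C 0 = T`. -/
def Cvar : ℕ → ComVariety
  | 0 => Tvar
  | m + 1 => comVar {(wpow (ltr 0) (m + 1), wpow (ltr 0) (m + 2)), commId}

/-- `D m = var{xᵐ = 0, xy = yx}`. -/
def Dvar (m : ℕ) : ComVariety := comVar ({commId} ∪ zeroId (wpow (ltr 0) m) 1)

/-- The word `x₁x₂⋯x_k` (in the letters `0, 1, …, k-1`), for `k ≥ 1`. -/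
def chainWord : ℕ → SGWord
  | 0 => ltr 0
  | 1 => ltr 0
  | k + 2 => chainWord (k + 1) * ltr (k + 1)

/-- `N k = var{x² = x₁x₂⋯x_k = 0, xy = yx}`. -/
def Nvar (k : ℕ) : ComVariety :=
  comVar ({commId} ∪ zeroId (wpow (ltr 0) 2) 1 ∪ zeroId (chainWord k) k)

/-- `N_ω = var{x² = 0, xy = yx}`. -/
def Nomegavar : ComVariety := comVar ({commId} ∪ zeroId (wpow (ltr 0) 2) 1)

/-- `N₃ᶜ = var{xyz = 0, xy = yx}`. -/
def N3cvar : ComVariety := comVar ({commId} ∪ zeroId (ltr 0 * ltr 1 * ltr 2) 3)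

/-! ### Semantic notions -/

/-- A semigroup `S` belongs to the variety `V` if it satisfies every identity of `V`. -/
def VMem (S : Type) [Semigroup S] (V : ComVariety) : Prop :=
  ∀ i ∈ V.theory, SGSatisfies S i

/-- `spow a n` is the power `aⁿ` in a semigroup (for `n ≥ 1`; by convention `spow a 0 = a`). -/
def spow {S : Type} [Semigroup S] (a : S) : ℕ → S
  | 0 => a
  | 1 => a
  | n + 2 => spow a (n + 1) * a

/-- A semigroup is a group. -/
def IsGroupSG (S : Type) [Semigroup S] : Prop :=
  ∃ e : S, (∀ a, e * a = a ∧ a * e = a) ∧ ∀ a, ∃ b, a * b = e ∧ b * a = e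

/-- A semigroup is periodic: every element generates a finite cyclic subsemigroup. -/
def IsPeriodicSG (S : Type) [Semigroup S] : Prop :=
  ∀ a : S, ∃ i j : ℕ, 1 ≤ i ∧ i < j ∧ spow a i = spow a j

/-- A semigroup is a nil-semigroup: it has a zero element and every element has a
power equal to zero. -/
def IsNilSG (S : Type) [Semigroup S] : Prop :=
  ∃ z : S, (∀ a, z * a = z ∧ a * z = z) ∧ ∀ a, ∃ n, 1 ≤ n ∧ spow a n = z

/-- A variety all of whose members are groups. -/
def IsGroupVariety (V : ComVariety) : Prop := ∀ S ∈ modelsOf V.theory, IsGroupSG S.carrier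

/-- A variety all of whose members are periodic semigroups. -/
def IsPeriodicVariety (V : ComVariety) : Prop := ∀ S ∈ modelsOf V.theory, IsPeriodicSG S.carrier

/-- A nil-variety: a variety all of whose members are nil-semigroups. -/
def IsNilVariety (V : ComVariety) : Prop := ∀ S ∈ modelsOf V.theory, IsNilSG S.carrier

/-- A combinatorial variety: all groups in it are trivial. -/
def IsCombinatorial (V : ComVariety) : Prop :=
  ∀ S ∈ modelsOf V.theory, IsGroupSG S.carrier → ∀ a b : S.carrier, a = b

/-- `K` is the variety generated by the semigroup `M` (with explicit semigroup
structure `inst`): the smallest variety containing `M`. -/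
def GeneratedBy (M : Type) (inst : Semigroup M) (K : ComVariety) : Prop :=
  IsLeast {W : ComVariety | ∀ i ∈ W.theory, @SGSatisfies M inst i} K

/-- A neutral element of a lattice. -/
def IsNeutralElt {α : Type*} [Lattice α] (x : α) : Prop :=
  ∀ y z, (x ⊔ y) ⊓ (y ⊔ z) ⊓ (z ⊔ x) = (x ⊓ y) ⊔ (y ⊓ z) ⊔ (z ⊓ x)

/-- A chain variety: a variety whose lattice of subvarieties is a chain. -/
def IsChainVariety (V : ComVariety) : Prop :=
  ∀ W₁ W₂ : ComVariety, W₁ ≤ V → W₂ ≤ V → W₁ ≤ W₂ ∨ W₂ ≤ W₁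

/-- A variety is 0-reduced in **Com** if it is given within `COM` by 0-reduced
identities (identities of the form `w = 0`) only. -/
def IsZeroReduced (V : ComVariety) : Prop :=
  ∃ P : Set (SGWord × ℕ), (∀ p ∈ P, ¬ OccursIn p.2 p.1) ∧
    V = comVar (⋃ p ∈ P, zeroId p.1 p.2)

/-- `ZR V`: the least variety 0-reduced in **Com** that contains `V`. -/
def ZRv (V : ComVariety) : ComVariety := sInf {W : ComVariety | IsZeroReduced W ∧ V ≤ W}

/-! ### Varieties and their models -/

theorem mem_modelsOf_comVar {E : Set SGId} {S : ComSG} :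
    S ∈ modelsOf (comVar E).theory ↔ S ∈ modelsOf E :=
  ⟨fun h i hi => h i (subset_theoryOfClass_modelsOf E hi), fun h _ hi => hi S h⟩

theorem ComVariety.le_iff_models {V W : ComVariety} :
    V ≤ W ↔ ∀ S ∈ modelsOf V.theory, S ∈ modelsOf W.theory := by
  refine ⟨fun h S hS => modelsOf_antitone h hS, fun h => ?_⟩
  have := theoryOfClass_antitone h
  rwa [V.closed, W.closed] at this

theorem ComVariety.le_of_subsingleton {V : ComVariety}
    (h : ∀ S ∈ modelsOf V.theory, ∀ a b : S.carrier, a = b) (W : ComVariety) : V ≤ W :=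
  ComVariety.le_iff_models.2 fun S hS _ _ _ => h S hS _ _

/-! ### Evaluation of words -/

/-- The list of letters of a word. -/
def letters (w : SGWord) : List ℕ := w.head :: w.tail

section Evaluation

variable {S : Type} [CommSemigroup S]

theorem coe_lift (f : ℕ → S) (w : SGWord) :
    ((FreeSemigroup.lift f w : S) : WithOne S) =
      ((letters w).map fun x => (f x : WithOne S)).prod := by
  induction w using FreeSemigroup.recOnMul with
  | ih1 x => simp [letters]
  | ih2 x y h1 h2 =>
    rw [map_mul, WithOne.coe_mul, h1, h2]
    simp [letters]

theorem coe_lift_wpow (f : ℕ → S) (w : SGWord) (n : ℕ) :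
    ((FreeSemigroup.lift f (wpow w (n + 1)) : S) : WithOne S) =
      (FreeSemigroup.lift f w : WithOne S) ^ (n + 1) := by
  induction n with
  | zero => simp [wpow]
  | succ n ih =>
    rw [wpow, map_mul, WithOne.coe_mul, ih, ← pow_succ]

theorem exists_coe_eq_pow (a : S) {n : ℕ} (hn : n ≠ 0) :
    ∃ c : S, (c : WithOne S) = (a : WithOne S) ^ n := by
  obtain ⟨m, rfl⟩ := Nat.exists_eq_succ_of_ne_zero hn
  exact ⟨FreeSemigroup.lift (fun _ => a) (wpow (ltr 0) (m + 1)), by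
    rw [coe_lift_wpow]; simp [ltr]⟩

theorem prod_map_ite_eq_pow {M : Type*} [CommMonoid M] (l : List ℕ) (y : ℕ) (A B : M) :
    (l.map fun x => if x = y then B else A).prod =
      B ^ l.count y * A ^ l.countP (fun x => x ≠ y) := by
  induction l with
  | nil => simp
  | cons x l ih =>
    by_cases h : x = y
    · subst h; simp [ih, pow_succ]; ac_rfl
    · simp [ih, pow_succ, h]; ac_rfl

/-- Evaluating one letter at `b` and all the others at `a`. -/
theorem coe_lift_ite (w : SGWord) (y : ℕ) (a b : S) :
    ((FreeSemigroup.lift (fun x => if x = y then b else a) w : S) : WithOne S) =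
      (b : WithOne S) ^ (letters w).count y *
        (a : WithOne S) ^ (letters w).countP (fun x => x ≠ y) := by
  rw [coe_lift, ← prod_map_ite_eq_pow]
  congr 2
  ext x
  split_ifs <;> rfl

theorem coe_lift_const (w : SGWord) (a : S) :
    ((FreeSemigroup.lift (fun _ => a) w : S) : WithOne S) =
      (a : WithOne S) ^ (w.tail.length + 1) := by
  rw [coe_lift]
  simp [letters, pow_succ, mul_comm]

theorem coe_lift_eq_prod (f : ℕ → S) (w : SGWord) {F : Finset ℕ}
    (hF : (letters w).toFinset ⊆ F) :
    ((FreeSemigroup.lift f w : S) : WithOne S) =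
      ∏ x ∈ F, (f x : WithOne S) ^ (letters w).count x := by
  rw [coe_lift, Finset.prod_list_map_count]
  refine Finset.prod_subset hF fun x _ hx => ?_
  rw [List.count_eq_zero_of_not_mem (by simpa using hx), pow_zero]

theorem lift_eq_of_idempotent (h : ∀ a : S, a * a = a) {u v : SGWord}
    (huv : (letters u).toFinset = (letters v).toFinset) (f : ℕ → S) :
    FreeSemigroup.lift f u = FreeSemigroup.lift f v := by
  have key (w : SGWord) : ((FreeSemigroup.lift f w : S) : WithOne S) =
      ∏ x ∈ (letters w).toFinset, (f x : WithOne S) := by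
    rw [coe_lift_eq_prod f w subset_rfl]
    refine Finset.prod_congr rfl fun x hx => ?_
    have hid : IsIdempotentElem (f x : WithOne S) := by
      rw [IsIdempotentElem, ← WithOne.coe_mul, h]
    obtain ⟨k, hk⟩ := Nat.exists_eq_succ_of_ne_zero
      (List.count_pos_iff.2 (List.mem_toFinset.1 hx)).ne'
    rw [hk, hid.pow_succ_eq]
  rw [← WithOne.coe_inj, key, key, huv]

theorem lift_eq_of_count_modEq {n : ℕ} (hn : n ≠ 0)
    (h : ∀ a b : S, (a : WithOne S) ^ n * b = b) {u v : SGWord}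
    (huv : ∀ x, (letters u).count x ≡ (letters v).count x [MOD n]) (f : ℕ → S) :
    FreeSemigroup.lift f u = FreeSemigroup.lift f v := by
  obtain ⟨e, he⟩ := exists_coe_eq_pow (f 0) hn
  have hpow (c : S) (k : ℕ) :
      (c : WithOne S) ^ k * e = (c : WithOne S) ^ (k % n) * e := by
    have hc : ∀ m : ℕ, ((c : WithOne S) ^ n) ^ m * e = e := by
      intro m
      induction m with
      | zero => simp
      | succ m ih => rw [pow_succ, mul_assoc, h, ih]
    conv_lhs => rw [← Nat.mod_add_div k n, pow_add, pow_mul, mul_assoc, hc]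
  have hee : IsIdempotentElem (e : WithOne S) := by
    have := h (f 0) e
    rwa [← he] at this
  have key (w : SGWord) {F : Finset ℕ} (hF : (letters w).toFinset ⊆ F) :
      ((FreeSemigroup.lift f w : S) : WithOne S) =
        ∏ x ∈ F, ((f x : WithOne S) ^ ((letters w).count x % n) * e) := by
    have h1 : ((FreeSemigroup.lift f w : S) : WithOne S) =
        (FreeSemigroup.lift f w : S) * (e : WithOne S) := by
      rw [mul_comm, he, h]
    have hcard : ∃ k, F.card = k + 1 :=
      Nat.exists_eq_succ_of_ne_zero (Finset.card_ne_zero_of_mem (a := w.head)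
        (hF (by simp [letters])))
    obtain ⟨k, hk⟩ := hcard
    rw [h1, coe_lift_eq_prod f w hF]
    simp_rw [← hpow]
    rw [Finset.prod_mul_distrib, Finset.prod_const, hk, hee.pow_succ_eq]
  rw [← WithOne.coe_inj, key u Finset.subset_union_left,
    key v (F := (letters u).toFinset ∪ (letters v).toFinset) Finset.subset_union_right]
  exact Finset.prod_congr rfl fun x _ => by rw [huv x]

end Evaluation

/-! ### Models of the named varieties -/

theorem mem_models_Avar {n : ℕ} (hn : n ≠ 0) {S : ComSG} :
    S ∈ modelsOf (Avar n).theory ↔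
      ∀ a b : S.carrier, (a : WithOne S.carrier) ^ n * b = b := by
  obtain ⟨m, rfl⟩ := Nat.exists_eq_succ_of_ne_zero hn
  rw [Avar, mem_modelsOf_comVar]
  constructor
  · intro h a b
    have := h _ (Set.mem_insert _ _) (fun x => if x = 0 then a else b)
    rw [← WithOne.coe_inj] at this
    simpa [coe_lift_wpow, ltr] using this
  · rintro h i (rfl | rfl) f
    · rw [← WithOne.coe_inj]
      simpa [coe_lift_wpow, ltr] using h (f 0) (f 1)
    · simp [commId, mul_comm]

theorem mem_models_SLvar {S : ComSG} :
    S ∈ modelsOf SLvar.theory ↔ ∀ a : S.carrier, a * a = a := by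
  rw [SLvar, mem_modelsOf_comVar]
  constructor
  · intro h a
    simpa [wpow, ltr] using h _ (Set.mem_insert _ _) (fun _ => a)
  · rintro h i (rfl | rfl) f
    · simpa [wpow, ltr] using h (f 0)
    · simp [commId, mul_comm]

theorem mem_models_ZMvar {S : ComSG} :
    S ∈ modelsOf ZMvar.theory ↔ ∀ a b c d : S.carrier, a * b = c * d := by
  rw [ZMvar, mem_modelsOf_comVar]
  constructor
  · intro h
    have key (a b c : S.carrier) : a * b * c = a * b := by
      simpa [ltr] using h (ltr 0 * ltr 1 * ltr 2, ltr 0 * ltr 1) (by simp [zeroId])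
        (fun x => if x = 0 then a else if x = 1 then b else c)
    intro a b c d
    rw [← key a b (c * d), mul_comm, key]
  · rintro h i (rfl | rfl | rfl) f
    · simp [commId, mul_comm]
    · simpa [ltr] using h _ _ _ _
    · simpa [ltr] using h _ _ _ _

/-! ### Varieties not containing the null semigroups -/

/-- `k` is a period of `V` if `V` satisfies `x ^ (k + 1) = x`. -/
def IsPeriod (V : ComVariety) (k : ℕ) : Prop :=
  ∀ S ∈ modelsOf V.theory, ∀ a : S.carrier, (a : WithOne S.carrier) ^ (k + 1) = a

theorem IsPeriod.sub {V : ComVariety} {k l : ℕ} (hk : IsPeriod V k) (hl : IsPeriod V l) :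
    IsPeriod V (k - l) := by
  rcases le_total k l with h | h
  · simp [Nat.sub_eq_zero_of_le h, IsPeriod]
  · intro S hS a
    have := hk S hS a
    rwa [show k + 1 = l + 1 + (k - l) by omega, pow_add, hl S hS, ← pow_succ'] at this

theorem IsPeriod.dvd_of_minimal {V : ComVariety} {n k : ℕ} (hn : IsPeriod V n) (hn0 : n ≠ 0)
    (hmin : ∀ m, m ≠ 0 → IsPeriod V m → n ≤ m) (hk : IsPeriod V k) : n ∣ k := by
  induction k using Nat.strong_induction_on with
  | _ k ih =>
    rcases eq_or_ne k 0 with rfl | hk0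
    · exact dvd_zero n
    · have hle := hmin k hk0 hk
      exact (Nat.dvd_sub_iff_left hle dvd_rfl).1 (ih (k - n) (by omega) (hk.sub hn))

theorem isPeriod_mul {V : ComVariety} {n : ℕ} (hn : IsPeriod V n) (m : ℕ) :
    IsPeriod V (n * m) := by
  intro S hS a
  induction m with
  | zero => simp
  | succ m ih =>
    rw [show n * (m + 1) + 1 = (n * m + 1) + n by ring, pow_add, ih, ← pow_succ', hn S hS]

theorem isPeriod_sub_of_pow_eq {V : ComVariety} {n A B : ℕ} (hn0 : n ≠ 0) (hn : IsPeriod V n)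
    (h : ∀ S ∈ modelsOf V.theory, ∀ a : S.carrier,
      (a : WithOne S.carrier) ^ A = (a : WithOne S.carrier) ^ B) : IsPeriod V (B - A) := by
  rcases le_total B A with hle | hle
  · simp [Nat.sub_eq_zero_of_le hle, IsPeriod]
  · intro S hS a
    have hA : A ≤ n * A := Nat.le_mul_of_pos_left A (Nat.pos_of_ne_zero hn0)
    have := congrArg (fun t => t * (a : WithOne S.carrier) ^ (n * A - A + 1)) (h S hS a)
    simp only [← pow_add] at this
    rw [show A + (n * A - A + 1) = n * A + 1 by omega, isPeriod_mul hn A S hS,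
      show B + (n * A - A + 1) = n * A + 1 + (B - A) by omega, pow_add,
      isPeriod_mul hn A S hS, ← pow_succ'] at this
    exact this.symm

theorem exists_isPeriod_of_mem_theory {V : ComVariety} {x : ℕ} {v : SGWord}
    (h : (ltr x, v) ∈ V.theory) (hv : v ≠ ltr x) : ∃ n, n ≠ 0 ∧ IsPeriod V n := by
  rcases v with ⟨y, _ | ⟨z, t⟩⟩
  · refine ⟨1, one_ne_zero, fun S hS a => ?_⟩
    have hxy : y ≠ x := fun hxy => hv (by rw [hxy]; rfl)
    have := hS _ h (fun i => if i = x then a * a else a)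
    rw [← WithOne.coe_inj, coe_lift, coe_lift] at this
    simpa [letters, ltr, hxy, sq, FreeSemigroup.of] using this
  · refine ⟨t.length + 1, Nat.succ_ne_zero _, fun S hS a => ?_⟩
    have := hS _ h (fun _ => a)
    rw [← WithOne.coe_inj, coe_lift_const, coe_lift_const] at this
    simpa [ltr, FreeSemigroup.of] using this.symm

theorem mem_theory_symm {V : ComVariety} {u v : SGWord} (h : (u, v) ∈ V.theory) :
    (v, u) ∈ V.theory := by
  rw [← V.closed] at h ⊢
  exact fun S hS f => (h S hS f).symm

theorem exists_isPeriod {V : ComVariety} (h : ¬ ZMvar ≤ V) : ∃ n, n ≠ 0 ∧ IsPeriod V n := by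
  contrapose! h
  refine ComVariety.le_iff_models.2 fun S hS => ?_
  rintro ⟨u, v⟩ huv f
  rw [mem_models_ZMvar] at hS
  rcases u with ⟨x, _ | ⟨z, t⟩⟩
  · by_cases hv : v = ltr x
    · rw [hv]; rfl
    · obtain ⟨n, hn0, hn⟩ := exists_isPeriod_of_mem_theory (x := x) huv hv
      exact absurd hn (h n hn0)
  · rcases v with ⟨y, _ | ⟨z', t'⟩⟩
    · obtain ⟨n, hn0, hn⟩ := exists_isPeriod_of_mem_theory (x := y) (mem_theory_symm huv)
        (by simp [ltr, FreeSemigroup.of])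
      exact absurd hn (h n hn0)
    · have split (x z : ℕ) (t : List ℕ) :
          (⟨x, z :: t⟩ : SGWord) = FreeSemigroup.of x * ⟨z, t⟩ := rfl
      dsimp only
      rw [split, split, map_mul, map_mul]
      exact hS _ _ _ _

theorem Avar_le_of_minimal_period {V : ComVariety} {n : ℕ} (hn : IsPeriod V n) (hn0 : n ≠ 0)
    (hmin : ∀ m, m ≠ 0 → IsPeriod V m → n ≤ m) : Avar n ≤ V := by
  refine ComVariety.le_iff_models.2 fun S hS => ?_
  rintro ⟨u, v⟩ huv f
  refine lift_eq_of_count_modEq hn0 ((mem_models_Avar hn0).1 hS) (fun x => ?_) f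
  set p := (letters u).count x + n * (letters u).countP (fun y => y ≠ x) with hp
  set q := (letters v).count x + n * (letters v).countP (fun y => y ≠ x) with hq
  have hpq : ∀ S ∈ modelsOf V.theory, ∀ a : S.carrier,
      (a : WithOne S.carrier) ^ p = (a : WithOne S.carrier) ^ q := by
    intro S hS a
    obtain ⟨e, he⟩ := exists_coe_eq_pow a hn0
    have := hS _ huv (fun i => if i = x then a else e)
    rw [← WithOne.coe_inj] at this
    dsimp only at this
    rwa [coe_lift_ite, coe_lift_ite, he, ← pow_mul, ← pow_mul, ← pow_add, ← pow_add] at this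
  have hmod : p ≡ q [MOD n] := by
    have d1 := hn.dvd_of_minimal hn0 hmin (isPeriod_sub_of_pow_eq hn0 hn hpq)
    have d2 := hn.dvd_of_minimal hn0 hmin
      (isPeriod_sub_of_pow_eq hn0 hn fun S hS a => (hpq S hS a).symm)
    rcases le_total p q with h | h
    · exact (Nat.modEq_iff_dvd' h).2 d1
    · exact ((Nat.modEq_iff_dvd' h).2 d2).symm
  simpa [hp, hq, Nat.ModEq] using hmod

theorem pow_eq_pow_mul_pow {V : ComVariety} {n : ℕ} (hn0 : n ≠ 0) (hn : IsPeriod V n)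
    {u v : SGWord} (huv : (u, v) ∈ V.theory) {y : ℕ} (hu : y ∉ letters u) (hv : y ∈ letters v)
    {S : ComSG} (hS : S ∈ modelsOf V.theory) (a b : S.carrier) :
    (a : WithOne S.carrier) ^ n = (a : WithOne S.carrier) ^ n * (b : WithOne S.carrier) ^ n := by
  have hid (c : S.carrier) : IsIdempotentElem ((c : WithOne S.carrier) ^ n) := by
    obtain ⟨m, rfl⟩ := Nat.exists_eq_succ_of_ne_zero hn0
    rw [IsIdempotentElem, ← pow_add, show m.succ + m.succ = (m + 1 + 1) + m by omega, pow_add,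
      hn S hS, ← pow_succ']
  obtain ⟨e, he⟩ := exists_coe_eq_pow a hn0
  obtain ⟨g, hg⟩ := exists_coe_eq_pow b hn0
  have := hS _ huv (fun i => if i = y then g else e)
  rw [← WithOne.coe_inj] at this
  dsimp only at this
  rw [coe_lift_ite, coe_lift_ite, List.count_eq_zero_of_not_mem hu, pow_zero, one_mul, he, hg]
    at this
  obtain ⟨j, hj⟩ := Nat.exists_eq_succ_of_ne_zero (List.count_pos_iff.2 hv).ne'
  rw [hj, (hid b).pow_succ_eq] at this
  have habs (k : ℕ) : (a : WithOne S.carrier) ^ n * ((a : WithOne S.carrier) ^ n) ^ k =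
      (a : WithOne S.carrier) ^ n := by
    rw [← pow_succ', (hid a).pow_succ_eq]
  have h2 := congrArg (fun t => (a : WithOne S.carrier) ^ n * t) this
  rwa [habs, mul_left_comm, habs, mul_comm] at h2

theorem le_Avar_of_isPeriod {V : ComVariety} {n : ℕ} (hn0 : n ≠ 0) (hn : IsPeriod V n)
    (h : ¬ SLvar ≤ V) : V ≤ Avar n := by
  obtain ⟨u, v, huv, y, hu, hv⟩ : ∃ u v, (u, v) ∈ V.theory ∧
      ∃ y, y ∉ letters u ∧ y ∈ letters v := by
    contrapose! h
    refine ComVariety.le_iff_models.2 fun S hS => ?_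
    rintro ⟨u, v⟩ huv f
    refine lift_eq_of_idempotent (mem_models_SLvar.1 hS) ?_ f
    ext y
    rw [List.mem_toFinset, List.mem_toFinset]
    exact ⟨not_imp_not.1 (h _ _ (mem_theory_symm huv) y), not_imp_not.1 (h _ _ huv y)⟩
  refine ComVariety.le_iff_models.2 fun S hS => (mem_models_Avar hn0).2 fun a b => ?_
  rw [pow_eq_pow_mul_pow hn0 hn huv hu hv hS a b, mul_comm (_ ^ n),
    ← pow_eq_pow_mul_pow hn0 hn huv hu hv hS b a, ← pow_succ, hn S hS]

theorem exists_exponent {V : ComVariety} (h : ¬ ZMvar ≤ V) :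
    ∃ n, n ≠ 0 ∧ IsPeriod V n ∧ Avar n ≤ V := by
  classical
  have hex := exists_isPeriod h
  obtain ⟨hn0, hn⟩ := Nat.find_spec hex
  exact ⟨Nat.find hex, hn0, hn,
    Avar_le_of_minimal_period hn hn0 fun m hm0 hm => Nat.find_min' hex ⟨hm0, hm⟩⟩

theorem exists_eq_Avar {V : ComVariety} (hZ : ¬ ZMvar ≤ V) (hS : ¬ SLvar ≤ V) :
    ∃ n, n ≠ 0 ∧ V = Avar n := by
  obtain ⟨n, hn0, hn, hle⟩ := exists_exponent hZ
  exact ⟨n, hn0, le_antisymm (le_Avar_of_isPeriod hn0 hn hS) hle⟩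

/-! ### Separating the atoms -/

theorem coe_pow_mul_coe {M : Type} [CommMonoid M] (a b : M) (n : ℕ) :
    (a : WithOne M) ^ n * b = ((a ^ n * b : M) : WithOne M) := by
  induction n with
  | zero => simp
  | succ n ih => rw [pow_succ', mul_assoc, ih, pow_succ', mul_assoc, ← WithOne.coe_mul]

theorem Avar_le_Avar_iff {m n : ℕ} (hm : m ≠ 0) (hn : n ≠ 0) :
    Avar m ≤ Avar n ↔ m ∣ n := by
  rw [ComVariety.le_iff_models]
  constructor
  · intro h
    have key := h ⟨Multiplicative (ZMod m)⟩ <| (mem_models_Avar hm).2 fun a b => by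
      change Multiplicative (ZMod m) at a b
      have ha : a ^ m = 1 := Multiplicative.toAdd.injective (by simp [toAdd_pow])
      exact (coe_pow_mul_coe a b m).trans (by rw [ha, one_mul])
    rw [mem_models_Avar hn] at key
    have := (coe_pow_mul_coe _ _ n).symm.trans
      (key (Multiplicative.ofAdd (1 : ZMod m)) (1 : Multiplicative (ZMod m)))
    replace this : Multiplicative.ofAdd (1 : ZMod m) ^ n = 1 := by
      rwa [WithOne.coe_inj, mul_one] at this
    rw [← ZMod.natCast_eq_zero_iff]
    simpa using congrArg Multiplicative.toAdd this
  · rintro ⟨k, rfl⟩ S hS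
    rw [mem_models_Avar hm] at hS
    rw [mem_models_Avar hn]
    intro a b
    obtain ⟨c, hc⟩ := exists_coe_eq_pow a (right_ne_zero_of_mul hn)
    rw [mul_comm m, pow_mul, ← hc, hS]

theorem isPeriod_Avar {n : ℕ} (hn : n ≠ 0) : IsPeriod (Avar n) n := fun S hS a => by
  rw [pow_succ, (mem_models_Avar hn).1 hS]

theorem isPeriod_one_iff {V : ComVariety} : IsPeriod V 1 ↔ V ≤ SLvar := by
  simp only [ComVariety.le_iff_models, mem_models_SLvar, IsPeriod, one_add_one_eq_two, sq,
    ← WithOne.coe_mul, WithOne.coe_inj]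

theorem IsPeriod.mono {V W : ComVariety} {n : ℕ} (h : V ≤ W) (hW : IsPeriod W n) :
    IsPeriod V n := fun S hS => hW S (ComVariety.le_iff_models.1 h S hS)

/-- The two-element null semigroup. -/
def nullTwo : ComSG where
  carrier := Bool
  str :=
    { mul _ _ := false
      mul_assoc _ _ _ := rfl
      mul_comm _ _ := rfl }

/-- The two-element semilattice. -/
def semilatticeTwo : ComSG where
  carrier := Bool
  str :=
    { mul := and
      mul_assoc := Bool.and_assoc
      mul_comm := Bool.and_comm }

theorem not_ZMvar_le_of_isPeriod {V : ComVariety} {n : ℕ} (hn0 : n ≠ 0) (hn : IsPeriod V n) :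
    ¬ ZMvar ≤ V := by
  intro h
  obtain ⟨z, t, hzt, hmul⟩ : ∃ z t : nullTwo.carrier, z ≠ t ∧ ∀ a b, a * b = z :=
    ⟨false, true, Bool.false_ne_true, fun _ _ => rfl⟩
  have := hn.mono h nullTwo (mem_models_ZMvar.2 fun _ _ _ _ => rfl) t
  obtain ⟨c, hc⟩ := exists_coe_eq_pow t hn0
  rw [pow_succ, ← hc, ← WithOne.coe_mul, WithOne.coe_inj, hmul] at this
  exact hzt this

theorem semilatticeTwo_mem :
    semilatticeTwo ∈ modelsOf SLvar.theory :=
  mem_models_SLvar.2 Bool.and_self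

theorem not_SLvar_le_Avar {n : ℕ} (hn : n ≠ 0) : ¬ SLvar ≤ Avar n := by
  intro h
  obtain ⟨z, t, hzt, hmul⟩ : ∃ z t : semilatticeTwo.carrier, z ≠ t ∧ z * t = z :=
    ⟨false, true, Bool.false_ne_true, rfl⟩
  have := (mem_models_Avar hn).1 (ComVariety.le_iff_models.1 h _ semilatticeTwo_mem) z t
  obtain ⟨m, rfl⟩ := Nat.exists_eq_succ_of_ne_zero hn
  have hid : IsIdempotentElem (z : WithOne semilatticeTwo.carrier) := by
    rw [IsIdempotentElem, ← WithOne.coe_mul, mem_models_SLvar.1 semilatticeTwo_mem]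
  rw [hid.pow_succ_eq, ← WithOne.coe_mul, WithOne.coe_inj, hmul] at this
  exact hzt this

/-- A variety in which every cube is a zero. -/
def CubesVanish (V : ComVariety) : Prop :=
  ∀ S ∈ modelsOf V.theory, ∀ a b : S.carrier, a * a * a * b = a * a * a

theorem not_SLvar_le_of_cubesVanish {V : ComVariety} (hV : CubesVanish V) : ¬ SLvar ≤ V := by
  intro h
  exact Bool.false_ne_true
    (hV _ (ComVariety.le_iff_models.1 h _ semilatticeTwo_mem) true false)

theorem eq_one_of_Avar_le_of_cubesVanish {V : ComVariety} (hV : CubesVanish V) {n : ℕ}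
    (hn : n ≠ 0) (h : Avar n ≤ V) : n = 1 := by
  rw [← Nat.dvd_one, ← Avar_le_Avar_iff hn one_ne_zero, ComVariety.le_iff_models]
  intro S hS
  have hcube := hV S (ComVariety.le_iff_models.1 h S hS)
  rw [mem_models_Avar hn] at hS
  refine (mem_models_Avar one_ne_zero).2 fun a b => ?_
  have hab : a * b = b := by
    have key (c : S.carrier) : (a : WithOne S.carrier) ^ n * (a : WithOne S.carrier) ^ n *
        (a : WithOne S.carrier) ^ n * c = c := by
      rw [mul_assoc, mul_assoc, hS, hS, hS]
    obtain ⟨e, he⟩ := exists_coe_eq_pow a hn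
    simp only [← he, ← WithOne.coe_mul, WithOne.coe_inj] at key
    have he' (c : S.carrier) : e * e * e = c := by rw [← key c, hcube]
    rw [← he' (a * b), he' b]
  rw [pow_one, ← WithOne.coe_mul, hab]

/-! ### Atoms -/

theorem eq_bot_of_subsingleton {V : ComVariety}
    (h : ∀ S ∈ modelsOf V.theory, ∀ a b : S.carrier, a = b) : V = ⊥ :=
  le_bot_iff.1 (ComVariety.le_of_subsingleton h ⊥)

theorem Avar_one : Avar 1 = ⊥ := by
  refine eq_bot_of_subsingleton fun S hS => ?_
  rw [mem_models_Avar one_ne_zero] at hS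
  simp only [pow_one, ← WithOne.coe_mul, WithOne.coe_inj] at hS
  exact fun a b => by rw [← hS a b, mul_comm, hS]

theorem isAtom_ZMvar : IsAtom ZMvar := by
  refine ⟨fun h => not_ZMvar_le_of_isPeriod one_ne_zero (isPeriod_Avar one_ne_zero)
    (h ▸ bot_le), fun V hV => ?_⟩
  obtain ⟨n, hn0, hn⟩ := exists_isPeriod hV.not_ge
  refine eq_bot_of_subsingleton fun S hS a b => ?_
  have hzero := mem_models_ZMvar.1 (ComVariety.le_iff_models.1 hV.le S hS)
  have key := hn S hS
  obtain ⟨c, hc⟩ := exists_coe_eq_pow a hn0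
  obtain ⟨d, hd⟩ := exists_coe_eq_pow b hn0
  rw [← WithOne.coe_inj, ← key a, ← key b, pow_succ, pow_succ, ← hc, ← hd, ← WithOne.coe_mul,
    ← WithOne.coe_mul, hzero]

theorem isPeriod_SLvar : IsPeriod SLvar 1 := isPeriod_one_iff.2 le_rfl

theorem isAtom_SLvar : IsAtom SLvar := by
  refine ⟨fun h => not_SLvar_le_Avar one_ne_zero (h ▸ bot_le), fun V hV => ?_⟩
  have h := le_Avar_of_isPeriod one_ne_zero (isPeriod_SLvar.mono hV.le) hV.not_ge
  rwa [Avar_one, le_bot_iff] at h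

theorem isAtom_Avar {p : ℕ} (hp : p.Prime) : IsAtom (Avar p) := by
  constructor
  · intro h
    exact hp.one_lt.ne' (Nat.dvd_one.1
      ((Avar_le_Avar_iff hp.ne_zero one_ne_zero).1 (h ▸ bot_le)))
  · intro V hV
    obtain ⟨n, hn0, rfl⟩ := exists_eq_Avar
      (fun h => not_ZMvar_le_of_isPeriod hp.ne_zero (isPeriod_Avar hp.ne_zero) (h.trans hV.le))
      (fun h => not_SLvar_le_Avar hp.ne_zero (h.trans hV.le))
    rcases (Nat.dvd_prime hp).1 ((Avar_le_Avar_iff hn0 hp.ne_zero).1 hV.le) with rfl | rfl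
    · exact Avar_one
    · exact absurd hV (lt_irrefl _)

theorem isAtom_iff {V : ComVariety} :
    IsAtom V ↔ V = ZMvar ∨ V = SLvar ∨ ∃ p : ℕ, p.Prime ∧ V = Avar p := by
  refine ⟨fun hV => ?_, ?_⟩
  · by_cases hZ : ZMvar ≤ V
    · exact Or.inl (hV.le_iff_eq isAtom_ZMvar.1 |>.1 hZ).symm
    by_cases hS : SLvar ≤ V
    · exact Or.inr (Or.inl (hV.le_iff_eq isAtom_SLvar.1 |>.1 hS).symm)
    obtain ⟨n, hn0, rfl⟩ := exists_eq_Avar hZ hS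
    have hn1 : n ≠ 1 := fun h => hV.1 (h ▸ Avar_one)
    obtain ⟨p, hp, hpn⟩ := Nat.exists_prime_and_dvd hn1
    exact Or.inr (Or.inr ⟨p, hp, (hV.le_iff_eq (isAtom_Avar hp).1 |>.1
      ((Avar_le_Avar_iff hp.ne_zero hn0).2 hpn)).symm⟩)
  · rintro (rfl | rfl | ⟨p, hp, rfl⟩)
    exacts [isAtom_ZMvar, isAtom_SLvar, isAtom_Avar hp]

/-! ### Distinguishing the atoms by the varieties that contain no other atom -/

section Order

variable {α : Type*} [Lattice α] [OrderBot α]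

/-- The only atom that can lie below `v` is `a`. -/
def OnlyAtom (a v : α) : Prop := ∀ b, IsAtom b → b ≤ v → b ≤ a

/-- Every `v` with no atoms other than `a` lies below `a`. -/
def IsThin (a : α) : Prop := ∀ v, OnlyAtom a v → v ≤ a

/-- The elements with no atoms other than `a` form a chain. -/
def IsChainAtom (a : α) : Prop :=
  ∀ v, OnlyAtom a v → ∀ w, OnlyAtom a w → v ≤ w ∨ w ≤ v

theorem IsThin.isChainAtom {a : α} (ha : IsAtom a) (h : IsThin a) : IsChainAtom a := by
  intro v hv w hw
  rcases ha.le_iff.1 (h v hv) with rfl | rfl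
  · exact Or.inl bot_le
  · exact Or.inr (h w hw)

end Order

theorem not_ZMvar_le_SLvar : ¬ ZMvar ≤ SLvar :=
  not_ZMvar_le_of_isPeriod one_ne_zero isPeriod_SLvar

theorem not_ZMvar_le_Avar {n : ℕ} (hn : n ≠ 0) : ¬ ZMvar ≤ Avar n :=
  not_ZMvar_le_of_isPeriod hn (isPeriod_Avar hn)

theorem not_Avar_le_SLvar {p : ℕ} (hp : p.Prime) : ¬ Avar p ≤ SLvar := by
  intro h
  have h1 := isAtom_SLvar.le_iff_eq (isAtom_Avar hp).1 |>.1 h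
  exact not_SLvar_le_Avar hp.ne_zero h1.ge

theorem isThin_SLvar : IsThin SLvar := by
  intro V hV
  obtain ⟨n, hn0, hn, hle⟩ := exists_exponent fun h => not_ZMvar_le_SLvar (hV _ isAtom_ZMvar h)
  obtain rfl : n = 1 := by
    by_contra hn1
    obtain ⟨p, hp, hpn⟩ := Nat.exists_prime_and_dvd hn1
    exact not_Avar_le_SLvar hp
      (hV _ (isAtom_Avar hp) (((Avar_le_Avar_iff hp.ne_zero hn0).2 hpn).trans hle))
  exact isPeriod_one_iff.1 hn

theorem onlyAtom_Avar_iff {p : ℕ} (hp : p.Prime) {V : ComVariety} :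
    OnlyAtom (Avar p) V ↔ ∃ k, V = Avar (p ^ k) := by
  constructor
  · intro hV
    obtain ⟨n, hn0, rfl⟩ := exists_eq_Avar
      (fun h => not_ZMvar_le_Avar hp.ne_zero (hV _ isAtom_ZMvar h))
      (fun h => not_SLvar_le_Avar hp.ne_zero (hV _ isAtom_SLvar h))
    refine ⟨n.primeFactorsList.length, congrArg Avar ?_⟩
    refine Nat.eq_prime_pow_of_unique_prime_dvd hn0 fun {q} hq hqn => ?_
    exact (Nat.prime_dvd_prime_iff_eq hq hp).1 ((Avar_le_Avar_iff hq.ne_zero hp.ne_zero).1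
      (hV _ (isAtom_Avar hq) ((Avar_le_Avar_iff hq.ne_zero hn0).2 hqn)))
  · rintro ⟨k, rfl⟩ W hW hWV
    have hk : p ^ k ≠ 0 := pow_ne_zero k hp.ne_zero
    rcases isAtom_iff.1 hW with rfl | rfl | ⟨q, hq, rfl⟩
    · exact absurd hWV (not_ZMvar_le_Avar hk)
    · exact absurd hWV (not_SLvar_le_Avar hk)
    · rw [Avar_le_Avar_iff hq.ne_zero hk] at hWV
      rw [(Nat.prime_dvd_prime_iff_eq hq hp).1 (hq.dvd_of_dvd_pow hWV)]

theorem isChainAtom_Avar {p : ℕ} (hp : p.Prime) : IsChainAtom (Avar p) := by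
  intro V hV W hW
  obtain ⟨k, rfl⟩ := (onlyAtom_Avar_iff hp).1 hV
  obtain ⟨l, rfl⟩ := (onlyAtom_Avar_iff hp).1 hW
  have h (i : ℕ) : p ^ i ≠ 0 := pow_ne_zero i hp.ne_zero
  rw [Avar_le_Avar_iff (h k) (h l), Avar_le_Avar_iff (h l) (h k)]
  exact (le_total k l).imp (pow_dvd_pow p) (pow_dvd_pow p)

theorem not_isThin_Avar {p : ℕ} (hp : p.Prime) : ¬ IsThin (Avar p) := by
  intro h
  have := h _ ((onlyAtom_Avar_iff hp).2 ⟨2, rfl⟩)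
  rw [Avar_le_Avar_iff (pow_ne_zero 2 hp.ne_zero) hp.ne_zero] at this
  have h2 := Nat.le_of_dvd hp.pos this
  nlinarith [hp.two_le]

theorem onlyAtom_ZMvar_of_cubesVanish {V : ComVariety} (hV : CubesVanish V) :
    OnlyAtom ZMvar V := by
  intro W hW hWV
  rcases isAtom_iff.1 hW with rfl | rfl | ⟨p, hp, rfl⟩
  · exact le_rfl
  · exact absurd hWV (not_SLvar_le_of_cubesVanish hV)
  · exact absurd (eq_one_of_Avar_le_of_cubesVanish hV hp.ne_zero hWV) hp.one_lt.ne'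

/-- The identity `x * x * y = x * x`. -/
def squareZeroId : SGId := (ltr 0 * ltr 0 * ltr 1, ltr 0 * ltr 0)

/-- The identity `x * y * z * t = x * y * z`. -/
def tripleZeroId : SGId := (ltr 0 * ltr 1 * ltr 2 * ltr 3, ltr 0 * ltr 1 * ltr 2)

theorem mem_models_squareZero {S : ComSG} :
    S ∈ modelsOf (comVar {squareZeroId}).theory ↔
      ∀ a b : S.carrier, a * a * b = a * a := by
  rw [mem_modelsOf_comVar]
  constructor
  · intro h a b
    simpa [squareZeroId, ltr] using h _ rfl (fun x => if x = 0 then a else b)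
  · rintro h i rfl f
    simpa [squareZeroId, ltr] using h (f 0) (f 1)

theorem mem_models_tripleZero {S : ComSG} :
    S ∈ modelsOf (comVar {tripleZeroId}).theory ↔
      ∀ a b c d : S.carrier, a * b * c * d = a * b * c := by
  rw [mem_modelsOf_comVar]
  constructor
  · intro h a b c d
    simpa [tripleZeroId, ltr] using h _ rfl
      (fun x => if x = 0 then a else if x = 1 then b else if x = 2 then c else d)
  · rintro h i rfl f
    simpa [tripleZeroId, ltr] using h (f 0) (f 1) (f 2) (f 3)

theorem cubesVanish_squareZero : CubesVanish (comVar {squareZeroId}) := by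
  intro S hS a b
  rw [mem_models_squareZero] at hS
  rw [hS, hS]

theorem cubesVanish_tripleZero : CubesVanish (comVar {tripleZeroId}) :=
  fun _ hS a b => mem_models_tripleZero.1 hS a a a b

/-- The monogenic semigroup `⟨a ∣ a ^ 3 = a ^ 4⟩`, where `i` stands for `a ^ (i + 1)`. -/
def cyclicThree : ComSG where
  carrier := Fin 3
  str :=
    { mul a b := if a = 0 ∧ b = 0 then 1 else 2
      mul_assoc := by decide
      mul_comm := by decide }

/-- Subsets of a three-element set under disjoint union, coded in binary; the code `0` is the
zero element. -/
def disjointUnionThree : ComSG where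
  carrier := Fin 8
  str :=
    { mul a b := if a = 0 ∨ b = 0 ∨ a &&& b ≠ 0 then 0 else a ||| b
      mul_assoc := by decide
      mul_comm := by decide }

instance : Fintype cyclicThree.carrier := inferInstanceAs (Fintype (Fin 3))

instance : DecidableEq cyclicThree.carrier := inferInstanceAs (DecidableEq (Fin 3))

instance : Fintype disjointUnionThree.carrier := inferInstanceAs (Fintype (Fin 8))

instance : DecidableEq disjointUnionThree.carrier := inferInstanceAs (DecidableEq (Fin 8))

theorem not_tripleZero_le_squareZero :
    ¬ comVar {tripleZeroId} ≤ comVar {squareZeroId} := fun h =>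
  absurd (mem_models_squareZero.1 (ComVariety.le_iff_models.1 h cyclicThree
    (mem_models_tripleZero.2 (by decide)))) (by decide)

theorem not_squareZero_le_tripleZero :
    ¬ comVar {squareZeroId} ≤ comVar {tripleZeroId} := fun h =>
  absurd (mem_models_tripleZero.1 (ComVariety.le_iff_models.1 h disjointUnionThree
    (mem_models_squareZero.2 (by decide)))
    (1 : Fin 8) (2 : Fin 8) (4 : Fin 8) (1 : Fin 8)) (by decide)

theorem not_isChainAtom_ZMvar : ¬ IsChainAtom ZMvar := fun h =>
  (h _ (onlyAtom_ZMvar_of_cubesVanish cubesVanish_squareZero) _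
    (onlyAtom_ZMvar_of_cubesVanish cubesVanish_tripleZero)).elim
    not_squareZero_le_tripleZero not_tripleZero_le_squareZero

theorem eq_SLvar_iff {V : ComVariety} : V = SLvar ↔ IsAtom V ∧ IsThin V := by
  refine ⟨?_, fun ⟨hV, hT⟩ => ?_⟩
  · rintro rfl
    exact ⟨isAtom_SLvar, isThin_SLvar⟩
  · rcases isAtom_iff.1 hV with rfl | rfl | ⟨p, hp, rfl⟩
    · exact absurd (hT.isChainAtom hV) not_isChainAtom_ZMvar
    · rfl
    · exact absurd hT (not_isThin_Avar hp)

theorem eq_ZMvar_iff {V : ComVariety} : V = ZMvar ↔ IsAtom V ∧ ¬ IsChainAtom V := by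
  refine ⟨?_, fun ⟨hV, hC⟩ => ?_⟩
  · rintro rfl
    exact ⟨isAtom_ZMvar, not_isChainAtom_ZMvar⟩
  · rcases isAtom_iff.1 hV with rfl | rfl | ⟨p, hp, rfl⟩
    · rfl
    · exact absurd (isThin_SLvar.isChainAtom hV) hC
    · exact absurd (isChainAtom_Avar hp) hC

theorem exists_eq_Avar_prime_iff {V : ComVariety} :
    (∃ p : ℕ, p.Prime ∧ V = Avar p) ↔ IsAtom V ∧ IsChainAtom V ∧ ¬ IsThin V := by
  refine ⟨?_, fun ⟨hV, hC, hT⟩ => ?_⟩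
  · rintro ⟨p, hp, rfl⟩
    exact ⟨isAtom_Avar hp, isChainAtom_Avar hp, not_isThin_Avar hp⟩
  · rcases isAtom_iff.1 hV with rfl | rfl | h
    · exact absurd hC not_isChainAtom_ZMvar
    · exact absurd isThin_SLvar hT
    · exact h

/-! ### First-order formulas -/

section Formulas

open FirstOrder.Language

/-- Variables available in the scope of `n` quantifiers. -/
abbrev FOVar (n : ℕ) : Type := Fin 1 ⊕ Fin n

/-- The most recently quantified variable. -/
def newVar (n : ℕ) : FOVar (n + 1) := Sum.inr (Fin.last n)

/-- A variable viewed in the scope of one more quantifier. -/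
def FOVar.up {n : ℕ} (s : FOVar n) : FOVar (n + 1) := Sum.map id Fin.castSucc s

/-- The formula `s ≤ t`, written as `s ⊔ t = t`. -/
def leFormula {n : ℕ} (s t : FOVar n) : latticeLang.BoundedFormula (Fin 1) n :=
  Term.bdEqual (Functions.apply₂ (show latticeLang.Functions 2 from true)
    (Term.var s) (Term.var t)) (Term.var t)

/-- The formula saying that `s` is the least element. -/
def botFormula {n : ℕ} (s : FOVar n) : latticeLang.BoundedFormula (Fin 1) n :=
  (leFormula s.up (newVar n)).all

/-- The formula saying that `s` is an atom. -/
def atomFormula {n : ℕ} (s : FOVar n) : latticeLang.BoundedFormula (Fin 1) n :=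
  (botFormula s).not ⊓
    ((leFormula (newVar n) s.up).imp (botFormula (newVar n) ⊔ leFormula s.up (newVar n))).all

/-- The formula saying that no atom other than `a` lies below `s`. -/
def onlyAtomFormula {n : ℕ} (a s : FOVar n) : latticeLang.BoundedFormula (Fin 1) n :=
  ((atomFormula (newVar n)).imp
    ((leFormula (newVar n) s.up).imp (leFormula (newVar n) a.up))).all

/-- The formula expressing `IsThin`. -/
def thinFormula {n : ℕ} (a : FOVar n) : latticeLang.BoundedFormula (Fin 1) n :=
  ((onlyAtomFormula a.up (newVar n)).imp (leFormula (newVar n) a.up)).all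

/-- The formula expressing `IsChainAtom`. -/
def chainFormula {n : ℕ} (a : FOVar n) : latticeLang.BoundedFormula (Fin 1) n :=
  ((onlyAtomFormula a.up (newVar n)).imp
    ((onlyAtomFormula a.up.up (newVar (n + 1))).imp
      (leFormula (newVar n).up (newVar (n + 1)) ⊔
        leFormula (newVar (n + 1)) (newVar n).up)).all).all

variable {L : Type*} {n : ℕ} (v : Fin 1 → L) (xs : Fin n → L)

@[simp] theorem elim_newVar (x : L) : Sum.elim v (Fin.snoc xs x) (newVar n) = x := by
  simp [newVar]

@[simp] theorem elim_up (s : FOVar n) (x : L) :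
    Sum.elim v (Fin.snoc xs x) s.up = Sum.elim v xs s := by
  rcases s with s | s <;> simp [FOVar.up]

variable [Lattice L]

@[simp] theorem realize_leFormula (s t : FOVar n) :
    (leFormula s t).Realize v xs ↔ Sum.elim v xs s ≤ Sum.elim v xs t := by
  rw [← sup_eq_right]
  exact BoundedFormula.realize_bdEqual _ _

variable [OrderBot L]

@[simp] theorem realize_botFormula (s : FOVar n) :
    (botFormula s).Realize v xs ↔ Sum.elim v xs s = ⊥ := by
  simp [botFormula, ← isBot_iff_eq_bot, IsBot]

@[simp] theorem realize_atomFormula (s : FOVar n) :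
    (atomFormula s).Realize v xs ↔ IsAtom (Sum.elim v xs s) := by
  simp only [atomFormula, BoundedFormula.realize_inf, BoundedFormula.realize_not,
    realize_botFormula, BoundedFormula.realize_all, BoundedFormula.realize_imp,
    realize_leFormula, elim_newVar, elim_up, BoundedFormula.realize_sup, isAtom_iff_le_of_ge]
  refine and_congr_right fun _ => forall_congr' fun x => ?_
  tauto

@[simp] theorem realize_onlyAtomFormula (a s : FOVar n) :
    (onlyAtomFormula a s).Realize v xs ↔ OnlyAtom (Sum.elim v xs a) (Sum.elim v xs s) := by
  simp [onlyAtomFormula, OnlyAtom]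

@[simp] theorem realize_thinFormula (a : FOVar n) :
    (thinFormula a).Realize v xs ↔ IsThin (Sum.elim v xs a) := by
  simp [thinFormula, IsThin]

@[simp] theorem realize_chainFormula (a : FOVar n) :
    (chainFormula a).Realize v xs ↔ IsChainAtom (Sum.elim v xs a) := by
  simp [chainFormula, IsChainAtom]

end Formulas

/-- **Theorem.** The set of varieties `{A p ∣ p prime}` is definable in the lattice
**Com**, and each of the varieties `SL` and `ZM` is a definable element of **Com**. -/
theorem definable_atoms :
    LatDefinable ComVariety {V : ComVariety | ∃ p : ℕ, p.Prime ∧ V = Avar p} ∧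
    LatDefinable ComVariety {V : ComVariety | V = SLvar} ∧
    LatDefinable ComVariety {V : ComVariety | V = ZMvar} := by
  refine ⟨⟨atomFormula (Sum.inl 0) ⊓ (chainFormula (Sum.inl 0) ⊓ (thinFormula (Sum.inl 0)).not),
      fun V => ?_⟩, ⟨atomFormula (Sum.inl 0) ⊓ thinFormula (Sum.inl 0), fun V => ?_⟩,
    ⟨atomFormula (Sum.inl 0) ⊓ (chainFormula (Sum.inl 0)).not, fun V => ?_⟩⟩
  · simp [Language.Formula.Realize, exists_eq_Avar_prime_iff]
  · simp [Language.Formula.Realize, eq_SLvar_iff]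
  · simp [Language.Formula.Realize, eq_ZMvar_iff]
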